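/- Let Y* = Ψ*(Ψ*)ᵀ be the cluster matrix of k equal-size clusters C*_1,…,C*_k of size ℓ, let Ψ̌ ∈ M_{n,k}, X̌ ∈ ℝ^{k×n}, and set Y̌ := Ψ̌X̌. For each a ∈ [k] define T_a := {i ∈ C*_a : ‖Y̌_{i•} − Y*_{i•}‖₁ < ℓ}, where M_{i•} denotes the i-th row of M. Then for every pair a ≠ b and every i ∈ T_a, j ∈ T_b, the i-th and j-th rows of Ψ̌ are distinct: Ψ̌_{i•} ≠ Ψ̌_{j•}. -/

import Mathlib

open Matrix Finset
open scoped BigOperators Classical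

noncomputable section

def EqualClusters {n k : ℕ} (σ : Fin n → Fin k) : Prop :=
  k ∣ n ∧ ∀ a : Fin k, (Finset.univ.filter fun i => σ i = a).card = n / k

def membershipMatrix {n k : ℕ} (σ : Fin n → Fin k) : Matrix (Fin n) (Fin k) ℝ :=
  fun i a => if σ i = a then 1 else 0

def IsMembership {n k : ℕ} (Ψ : Matrix (Fin n) (Fin k) ℝ) : Prop :=
  (∀ i a, Ψ i a = 0 ∨ Ψ i a = 1) ∧ (∀ i, ∃! a, Ψ i a = 1) ∧ ∀ a, ∃ i, Ψ i a = 1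

theorem membershipMatrix_mul_transpose_apply {n k : ℕ} (σ : Fin n → Fin k) (i t : Fin n) :
    (membershipMatrix σ * (membershipMatrix σ)ᵀ) i t = if σ t = σ i then 1 else 0 := by
  simp [Matrix.mul_apply, membershipMatrix, eq_comm]

/-- Rows of the cluster matrix belonging to different clusters are at `ℓ₁` distance `2 * n / k`. -/
theorem EqualClusters.sum_abs_sub_eq {n k : ℕ} {σ : Fin n → Fin k} (h : EqualClusters σ)
    (hk : 0 < k) {i j : Fin n} (hij : σ i ≠ σ j) :
    ∑ t, |(membershipMatrix σ * (membershipMatrix σ)ᵀ) i t -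
      (membershipMatrix σ * (membershipMatrix σ)ᵀ) j t| = 2 * ((n : ℝ) / k) := by
  have hcard (a : Fin k) : ∑ t, (if σ t = a then (1 : ℝ) else 0) = (n : ℝ) / k := by
    rw [Finset.sum_boole, h.2 a, Nat.cast_div h.1 (by positivity)]
  rw [two_mul]
  nth_rewrite 1 [← hcard (σ i)]
  rw [← hcard (σ j), ← Finset.sum_add_distrib]
  refine Finset.sum_congr rfl fun t _ => ?_
  simp only [membershipMatrix_mul_transpose_apply]
  by_cases hi : σ t = σ i
  · simp [hi, hij]
  · by_cases hj : σ t = σ j <;> simp [hi, hj, hij.symm]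

/-- Lemma 7: let `Y* = Ψ*(Ψ*)ᵀ` be the cluster matrix and `Y̌ = Ψ̌X̌`. If `i` and `j` belong
to different true clusters (`σ* i ≠ σ* j`) and their `Y̌` rows are within ℓ₁ distance `< ℓ` of
the corresponding rows of `Y*` (i.e. `i ∈ T_{σ* i}` and `j ∈ T_{σ* j}`), then the `i`-th and
`j`-th rows of `Ψ̌` are distinct. -/
theorem distinct_rows_across_clusters {n k : ℕ} (σstar : Fin n → Fin k)
    (hclusters : EqualClusters σstar) (hn : 0 < n) (hk : 0 < k) (hkn : k ≤ n)
    (Ψ : Matrix (Fin n) (Fin k) ℝ) (hΨ : IsMembership Ψ)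
    (X : Matrix (Fin k) (Fin n) ℝ)
    (i j : Fin n) (hab : σstar i ≠ σstar j)
    (hi : ∑ t, |(Ψ * X) i t -
        (membershipMatrix σstar * (membershipMatrix σstar)ᵀ) i t| < (n : ℝ) / k)
    (hj : ∑ t, |(Ψ * X) j t -
        (membershipMatrix σstar * (membershipMatrix σstar)ᵀ) j t| < (n : ℝ) / k) :
    Ψ i ≠ Ψ j := by
  intro hrow
  have hY (t : Fin n) : (Ψ * X) i t = (Ψ * X) j t := by
    simp only [Matrix.mul_apply, hrow]
  have htri := Finset.sum_le_sum fun t (_ : t ∈ Finset.univ) =>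
    abs_sub_le ((membershipMatrix σstar * (membershipMatrix σstar)ᵀ) i t) ((Ψ * X) j t)
      ((membershipMatrix σstar * (membershipMatrix σstar)ᵀ) j t)
  rw [hclusters.sum_abs_sub_eq hk hab, Finset.sum_add_distrib] at htri
  simp only [hY, abs_sub_comm ((Ψ * X) j _)] at hi
  linarith
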